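/- For all x > 0, (sinh x)/x > (1/3 + (2/3)·cosh^{8/5} x)^{5/16}. -/

import Mathlib

noncomputable def uu (x : ℝ) : ℝ := (Real.cosh x) ^ ((1 : ℝ) / 5)

lemma uu_pos (x : ℝ) : 0 < uu x := Real.rpow_pos_of_pos (Real.cosh_pos x) _

lemma uu_pow5 (x : ℝ) : uu x ^ 5 = Real.cosh x := by
  unfold uu
  rw [← Real.rpow_natCast, ← Real.rpow_mul (Real.cosh_pos x).le]
  norm_num

lemma uu_pow8 (x : ℝ) : uu x ^ 8 = Real.cosh x ^ ((8 : ℝ) / 5) := by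
  unfold uu
  rw [← Real.rpow_natCast, ← Real.rpow_mul (Real.cosh_pos x).le]
  norm_num

lemma uu_gt (x : ℝ) (hx : 0 < x) : 1 < uu x :=
  Real.one_lt_rpow (Real.one_lt_cosh.mpr hx.ne') (by norm_num)

lemma uu_zero : uu 0 = 1 := by simp [uu]

lemma uu_deriv (x : ℝ) : HasDerivAt uu (Real.sinh x / (5 * uu x ^ 4)) x := by
  have h := (Real.hasDerivAt_cosh x).rpow_const (p := (1 : ℝ) / 5) (Or.inl (Real.cosh_pos x).ne')
  have e : Real.cosh x ^ ((1 : ℝ) / 5 - 1) = 1 / uu x ^ 4 := by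
    rw [Real.rpow_sub (Real.cosh_pos x), Real.rpow_one, ← uu_pow5 x]
    have : (uu x ^ 5) ^ ((1 : ℝ) / 5) = uu x := by rw [uu_pow5]; rfl
    rw [this]
    have := (uu_pos x).ne'
    field_simp
  rw [e] at h
  refine HasDerivAt.congr_deriv (f := uu) h ?_
  have := (uu_pos x).ne'
  field_simp

lemma poly_pos (u : ℝ) (hu : 1 < u) :
    0 < -3*u^2 - 5*u^4 + 15*u^10 + u^12 + 5*u^14 - 20*u^20 + 2*u^22 + 5*u^30 := by
  obtain ⟨v, hv, rfl⟩ : ∃ v : ℝ, 0 < v ∧ u = 1 + v := ⟨u - 1, by linarith, by ring⟩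
  ring_nf
  positivity

noncomputable def hh (x : ℝ) : ℝ :=
  x - Real.sinh x * ((1 + 2 * uu x ^ 8) / (uu x ^ 13 + uu x ^ 5 + uu x ^ 3))

lemma hh_deriv (x : ℝ) : HasDerivAt hh
    ((-3*uu x^2 - 5*uu x^4 + 15*uu x^10 + uu x^12 + 5*uu x^14 - 20*uu x^20 + 2*uu x^22
      + 5*uu x^30) / (5 * uu x ^ 4 * (uu x ^ 13 + uu x ^ 5 + uu x ^ 3) ^ 2)) x := by
  have hp := uu_pos x
  have hd := uu_deriv x
  have hD : uu x ^ 13 + uu x ^ 5 + uu x ^ 3 ≠ 0 := by positivity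
  have hN := ((hd.pow 8).const_mul 2).const_add 1
  have hD' := ((hd.pow 13).add (hd.pow 5)).add (hd.pow 3)
  have h := (hasDerivAt_id x).sub ((Real.hasDerivAt_sinh x).mul (hN.div hD' hD))
  have hs : Real.sinh x ^ 2 = uu x ^ 10 - 1 := by
    rw [Real.sinh_sq, ← uu_pow5]; ring
  refine h.congr_deriv ?_
  simp only [Pi.add_apply, Pi.pow_apply, Pi.div_apply]
  rw [← uu_pow5 x]
  generalize uu x = u at *
  generalize Real.sinh x = s at *
  have hu := hp.ne'
  have hD2 : u ^ 10 + u ^ 2 + 1 ≠ 0 := by positivity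
  have e : u ^ 13 + u ^ 5 + u ^ 3 = u ^ 3 * (u ^ 10 + u ^ 2 + 1) := by ring
  rw [e]
  field_simp
  ring_nf
  rw [hs]
  ring

lemma hh_pos (x : ℝ) (hx : 0 < x) : 0 < hh x := by
  have hm : StrictMonoOn hh (Set.Ici 0) := by
    apply strictMonoOn_of_deriv_pos (convex_Ici 0)
    · exact fun y _ => (hh_deriv y).continuousAt.continuousWithinAt
    · intro y hy
      rw [interior_Ici] at hy
      rw [(hh_deriv y).deriv]
      have := uu_pos y
      exact div_pos (poly_pos _ (uu_gt y hy)) (by positivity)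
  have := hm (Set.mem_Ici.mpr le_rfl) (Set.mem_Ici.mpr hx.le) hx
  simpa [hh] using this

noncomputable def kk (x : ℝ) : ℝ := 5 / 16 * Real.log (1 / 3 + 2 / 3 * uu x ^ 8)

noncomputable def ff (x : ℝ) : ℝ := Real.log (Real.sinh x) - Real.log x - kk x

lemma kk_deriv (x : ℝ) : HasDerivAt kk
    (Real.sinh x * uu x ^ 3 / (1 + 2 * uu x ^ 8)) x := by
  have hp := uu_pos x
  have hd := uu_deriv x
  have h := (((((hd.pow 8).const_mul (2/3)).const_add (1/3)).log
    (by simp only [Pi.pow_apply]; positivity)).const_mul (5/16))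
  refine h.congr_deriv ?_
  simp only [Pi.pow_apply]
  have : 1 + 2 * uu x ^ 8 ≠ 0 := by positivity
  have e : 1 / 3 + 2 / 3 * uu x ^ 8 = (1 + 2 * uu x ^ 8) / 3 := by ring
  rw [e]
  field_simp
  norm_num
  ring

lemma ff_deriv (x : ℝ) (hx : 0 < x) : ∃ d, 0 < d ∧ HasDerivAt ff d x := by
  have hs := Real.sinh_pos_iff.mpr hx
  have h := (((Real.hasDerivAt_sinh x).log hs.ne').sub (Real.hasDerivAt_log hx.ne')).sub (kk_deriv x)
  refine ⟨_, ?_, h⟩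
  have hp := uu_pos x
  have hh0 := hh_pos x hx
  unfold hh at hh0
  have hs2 : Real.sinh x ^ 2 = uu x ^ 10 - 1 := by
    rw [Real.sinh_sq, ← uu_pow5]; ring
  rw [← uu_pow5 x]
  generalize uu x = u at *
  generalize Real.sinh x = s at *
  have hD : 0 < u ^ 13 + u ^ 5 + u ^ 3 := by positivity
  have e : u ^ 5 / s - x⁻¹ - s * u ^ 3 / (1 + 2 * u ^ 8) =
      (x - s * ((1 + 2 * u ^ 8) / (u ^ 13 + u ^ 5 + u ^ 3))) * (u ^ 13 + u ^ 5 + u ^ 3)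
        / (x * s * (1 + 2 * u ^ 8)) := by
    have h1 : (x - s * ((1 + 2 * u ^ 8) / (u ^ 13 + u ^ 5 + u ^ 3))) * (u ^ 13 + u ^ 5 + u ^ 3)
      = x * (u ^ 13 + u ^ 5 + u ^ 3) - s * (1 + 2 * u ^ 8) := by
      rw [sub_mul, mul_assoc, div_mul_cancel₀ _ hD.ne']
    rw [h1]
    have : 1 + 2 * u ^ 8 ≠ 0 := by positivity
    field_simp
    linear_combination (-x * u ^ 3) * hs2
  rw [e]
  positivity

lemma ff_pos (x : ℝ) (hx : 0 < x) : 0 < ff x := by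
  have hm : StrictMonoOn ff (Set.Ioi 0) := by
    apply strictMonoOn_of_deriv_pos (convex_Ioi 0)
    · intro y hy
      obtain ⟨d, _, h⟩ := ff_deriv y hy
      exact h.continuousAt.continuousWithinAt
    · intro y hy
      rw [interior_Ioi] at hy
      obtain ⟨d, hd, h⟩ := ff_deriv y hy
      rwa [h.deriv]
  have hx2 : 0 < x / 2 := by linarith
  have h1 : ff (x / 2) < ff x := hm hx2 hx (by linarith)
  have ht : Filter.Tendsto (fun y => - kk y) (nhdsWithin 0 (Set.Ioi 0)) (nhds 0) := by
    have h0 : kk 0 = 0 := by simp only [kk, uu_zero]; norm_num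
    have := (kk_deriv 0).continuousAt.tendsto.neg
    rw [h0, neg_zero] at this
    exact this.mono_left nhdsWithin_le_nhds
  have h2 : 0 ≤ ff (x / 2) := by
    refine le_of_tendsto ht ?_
    filter_upwards [Ioo_mem_nhdsGT hx2] with y hy
    have h3 : ff y < ff (x / 2) := hm hy.1 hx2 hy.2
    have h4 : Real.log y < Real.log (Real.sinh y) :=
      Real.log_lt_log hy.1 (Real.self_lt_sinh_iff.mpr hy.1)
    have h5 : ff y = Real.log (Real.sinh y) - Real.log y - kk y := rfl
    linarith
  linarith

theorem stmt_17 (x : ℝ) (hx : 0 < x) :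
    Real.sinh x / x > (1 / 3 + (2 / 3) * (Real.cosh x) ^ ((8 : ℝ) / 5)) ^ ((5 : ℝ) / 16) := by
  have hs := Real.sinh_pos_iff.mpr hx
  have hp := uu_pos x
  have h := ff_pos x hx
  rw [← uu_pow8]
  have hK : 0 < 1 / 3 + 2 / 3 * uu x ^ 8 := by positivity
  rw [gt_iff_lt, ← Real.log_lt_log_iff (by positivity) (by positivity), Real.log_rpow hK,
    Real.log_div hs.ne' hx.ne']
  unfold ff kk at h
  linarith
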